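/- Let (f_m) and f be nondegenerate integrable log-concave functions on ℝⁿ such that f_m → f pointwise. Then for every k with 0 < k < ‖f‖_∞, the super-level sets converge in the Hausdorff metric: G_{f_m}(k) → G_f(k) as m → ∞. -/

import Mathlib

open MeasureTheory Metric Set Filter

noncomputable section

abbrev En (n : ℕ) := EuclideanSpace ℝ (Fin n)

def LogConcaveFn {n : ℕ} (f : En n → ℝ) : Prop :=
  (∀ x, 0 ≤ f x) ∧
  ∀ x y : En n, ∀ l : ℝ, 0 ≤ l → l ≤ 1 →
    f x ^ l * f y ^ (1 - l) ≤ f (l • x + (1 - l) • y)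

/-- The super-level sets of a log-concave function at positive heights are convex. -/
theorem LogConcaveFn.convex_superlevel {n : ℕ} {f : En n → ℝ} (hf : LogConcaveFn f)
    {k : ℝ} (hk : 0 < k) : Convex ℝ {x | k ≤ f x} := by
  intro x hx y hy a b ha hb hab
  obtain rfl : b = 1 - a := by linarith
  calc k = k ^ a * k ^ (1 - a) := by
        rw [← Real.rpow_add hk]; simp
    _ ≤ f x ^ a * f y ^ (1 - a) :=
        mul_le_mul (Real.rpow_le_rpow hk.le hx ha) (Real.rpow_le_rpow hk.le hy hb)
          (Real.rpow_nonneg hk.le _) (Real.rpow_nonneg (hf.1 x) _)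
    _ ≤ f (a • x + (1 - a) • y) := hf.2 x y a ha (by linarith)

/-- Moving a point of the super-level set slightly towards a point of strictly larger value enters
the strict super-level set. -/
theorem LogConcaveFn.lt_of_le_of_lt {n : ℕ} {f : En n → ℝ} (hf : LogConcaveFn f) {k : ℝ}
    (hk : 0 < k) {x y : En n} (hx : k ≤ f x) (hy : k < f y) {t : ℝ} (ht0 : 0 < t) (ht1 : t ≤ 1) :
    k < f (t • y + (1 - t) • x) := by
  refine lt_of_lt_of_le ?_ (hf.2 y x t ht0.le ht1)
  calc k = k ^ t * k ^ (1 - t) := by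
        rw [← Real.rpow_add hk]; simp
    _ < f y ^ t * k ^ (1 - t) :=
        mul_lt_mul_of_pos_right (Real.rpow_lt_rpow hk.le hy ht0) (Real.rpow_pos_of_pos hk _)
    _ ≤ f y ^ t * f x ^ (1 - t) :=
        mul_le_mul_of_nonneg_left (Real.rpow_le_rpow hk.le hx (by linarith))
          (Real.rpow_nonneg (hf.1 y) _)

/-- The strict super-level sets of a nondegenerate log-concave function span the whole space. -/
theorem LogConcaveFn.affineSpan_superlevel_eq_top {n : ℕ} {f : En n → ℝ} (hf : LogConcaveFn f)
    (hnd : (interior {x | 0 < f x}).Nonempty) {k : ℝ} (hk : 0 < k) {y : En n} (hy : k < f y) :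
    affineSpan ℝ {x | k < f x} = ⊤ := by
  rw [eq_top_iff, ← isOpen_interior.affineSpan_eq_top hnd]
  refine affineSpan_le.2 fun v hv => ?_
  replace hv : v ∈ {x | 0 < f x} := interior_subset hv
  replace hv : 0 < f v := hv
  have hlim : Tendsto (fun t : ℝ => f v ^ t * f y ^ (1 - t)) (nhdsWithin 0 (Ioi 0))
      (nhds (f y)) := by
    have hc : ContinuousAt (fun t : ℝ => f v ^ t * f y ^ (1 - t)) 0 :=
      (Real.continuousAt_const_rpow hv.ne').mul
        (ContinuousAt.rpow continuousAt_const (by fun_prop) (Or.inl (hk.trans hy).ne'))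
    simpa using hc.tendsto.mono_left nhdsWithin_le_nhds
  obtain ⟨t, hkt, ht0, ht1⟩ := ((hlim.eventually_const_lt hy).and
    (Ioo_mem_nhdsGT (zero_lt_one (α := ℝ)))).exists
  have hw : AffineMap.lineMap y v t ∈ affineSpan ℝ {x | k < f x} := by
    refine subset_affineSpan ℝ _ ?_
    rw [AffineMap.lineMap_apply_module, add_comm]
    exact hkt.trans_le (hf.2 v y t ht0.le ht1.le)
  have h := AffineMap.lineMap_mem t⁻¹ (subset_affineSpan ℝ _ (show y ∈ {x | k < f x} from hy)) hw
  have hv' : AffineMap.lineMap y (AffineMap.lineMap y v t) t⁻¹ = v := by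
    simp [AffineMap.lineMap_apply, smul_smul, ht0.ne']
  rwa [hv'] at h

/-- A convex set of finite measure which contains a ball is bounded. -/
theorem Convex.isBounded_of_measure_lt_top {E : Type*} [NormedAddCommGroup E] [NormedSpace ℝ E]
    [MeasurableSpace E] [BorelSpace E] (μ : Measure E) [μ.IsAddHaarMeasure] {s : Set E}
    (hs : Convex ℝ s) {z : E} {r : ℝ} (hr : 0 < r) (hball : ball z r ⊆ s) (hμ : μ s < ⊤) :
    Bornology.IsBounded s := by
  set c : Set E := {x | ball x (r / 2) ⊆ s} with hc
  have hmid : ∀ x ∈ s, (2⁻¹ : ℝ) • z + (2⁻¹ : ℝ) • x ∈ c := by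
    intro x hx y hy
    have hw : z + (2 : ℝ) • (y - ((2⁻¹ : ℝ) • z + (2⁻¹ : ℝ) • x)) ∈ ball z r := by
      rw [mem_ball, dist_eq_norm] at hy ⊢
      rw [add_sub_cancel_left, norm_smul, Real.norm_eq_abs, abs_two]
      linarith
    have := hs (hball hw) hx (a := 2⁻¹) (b := 2⁻¹) (by norm_num) (by norm_num) (by norm_num)
    convert this using 1
    module
  suffices hcb : Bornology.IsBounded c by
    obtain ⟨R, hR⟩ := hcb.subset_closedBall z
    refine (isBounded_closedBall (x := z) (r := 2 * R)).subset fun x hx => ?_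
    have h := hR (hmid x hx)
    rw [mem_closedBall, dist_eq_norm] at h ⊢
    have he : x - z = (2 : ℝ) • ((2⁻¹ : ℝ) • z + (2⁻¹ : ℝ) • x - z) := by module
    rw [he, norm_smul, Real.norm_eq_abs, abs_two]
    linarith
  by_contra hcb
  obtain ⟨u, huc, hu⟩ := exists_seq_of_forall_finset_exists (fun x => x ∈ c)
    (fun x y => r ≤ dist x y) fun F _ => by
      by_contra! hF
      refine hcb (((Bornology.isBounded_biUnion_finset F).2
        fun x _ => isBounded_ball (x := x) (r := r)).subset fun y hy => ?_)
      obtain ⟨x, hxF, hxy⟩ := hF y hy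
      exact mem_iUnion₂.2 ⟨x, hxF, by rwa [mem_ball, dist_comm]⟩
  have hdisj : Pairwise (Function.onFun Disjoint fun i => ball (u i) (r / 2)) := by
    intro i j hij
    refine ball_disjoint_ball ?_
    rcases hij.lt_or_gt with h | h
    · linarith [hu i j h]
    · linarith [hu j i h, dist_comm (u i) (u j)]
  have htop : μ (⋃ i, ball (u i) (r / 2)) = ⊤ := by
    rw [measure_iUnion hdisj fun _ => measurableSet_ball]
    simp_rw [Measure.addHaar_ball_center μ _ (r / 2)]
    exact ENNReal.tsum_const_eq_top_of_ne_zero (measure_ball_pos μ _ (half_pos hr)).ne'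
  exact (htop ▸ (measure_mono (iUnion_subset fun i => huc i)).trans_lt hμ).ne rfl

/-- If a sequence of log-concave functions converges pointwise to a nondegenerate log-concave
function, then some ball lies in all but finitely many of their super-level sets. -/
theorem exists_ball_subset_superlevel {n : ℕ} {fm : ℕ → En n → ℝ} {f : En n → ℝ}
    (hlcm : ∀ m, LogConcaveFn (fm m)) (hlc : LogConcaveFn f)
    (hnd : (interior {x | 0 < f x}).Nonempty)
    (hptw : ∀ x, Tendsto (fun m => fm m x) atTop (nhds (f x)))
    {k : ℝ} (hk0 : 0 < k) {y : En n} (hy : k < f y) :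
    ∃ z, ∃ r > 0, ball z r ⊆ {x | k ≤ f x} ∧ ∀ᶠ m in atTop, ball z r ⊆ {x | k ≤ fm m x} := by
  obtain ⟨s, hsf, b, hb⟩ :=
    AffineBasis.exists_affine_subbasis (hlc.affineSpan_superlevel_eq_top hnd hk0 hy)
  have hfin : s.Finite := b.finite_set
  have hspan : affineSpan ℝ s = ⊤ := by simpa [hb] using b.tot
  obtain ⟨z, hz⟩ := interior_convexHull_nonempty_iff_affineSpan_eq_top.2 hspan
  obtain ⟨r, hr, hball⟩ := Metric.isOpen_iff.1 isOpen_interior z hz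
  replace hball := hball.trans interior_subset
  refine ⟨z, r, hr, hball.trans (convexHull_min (hsf.trans (ofPred_subset_ofPred.2 fun _ => le_of_lt))
    (hlc.convex_superlevel hk0)), ?_⟩
  filter_upwards [(hfin.eventually_all).2 fun x hx => (hptw x).eventually_const_lt (hsf hx)]
    with m hm
  exact hball.trans (convexHull_min (fun x hx => (hm x hx).le) ((hlcm m).convex_superlevel hk0))

/-- A totally bounded super-level set of the limit is eventually contained in the `ε`-neighbourhood
of the super-level sets of the sequence. -/
theorem eventually_superlevel_dist_le {n : ℕ} {fm : ℕ → En n → ℝ} {f : En n → ℝ}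
    (hlc : LogConcaveFn f) (hptw : ∀ x, Tendsto (fun m => fm m x) atTop (nhds (f x)))
    {k : ℝ} (hk0 : 0 < k) {y : En n} (hy : k < f y)
    (hbdd : TotallyBounded {x | k ≤ f x}) {ε : ℝ} (hε : 0 < ε) :
    ∀ᶠ m in atTop, ∀ x, k ≤ f x → ∃ w, k ≤ fm m w ∧ dist x w ≤ ε := by
  obtain ⟨F, hFs, hF, hcov⟩ := finite_approx_of_totallyBounded hbdd (ε / 2) (half_pos hε)
  have hnear : ∀ x ∈ F, ∃ w, k < f w ∧ dist x w ≤ ε / 2 := by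
    intro x hx
    have hd : 0 < dist x y + ε / 2 := by positivity
    refine ⟨_, hlc.lt_of_le_of_lt hk0 (hFs hx) hy (t := ε / 2 / (dist x y + ε / 2))
      (by positivity) ((div_le_one hd).2 (by linarith [dist_nonneg (x := x) (y := y)])), ?_⟩
    rw [add_comm, ← AffineMap.lineMap_apply_module, dist_left_lineMap, Real.norm_eq_abs,
      abs_of_pos (by positivity), div_mul_eq_mul_div, div_le_iff₀ hd]
    nlinarith
  choose! w hw hdist using hnear
  filter_upwards [(hF.eventually_all).2 fun x hx => (hptw (w x)).eventually_const_lt (hw x hx)]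
    with m hm x hx
  obtain ⟨v, hv, hxv⟩ := mem_iUnion₂.1 (hcov hx)
  exact ⟨w v, (hm v hv).le, by linarith [dist_triangle x v (w v), hdist v hv, mem_ball.1 hxv]⟩

/-- If a ball lies in almost all super-level sets of the sequence, then these are eventually
contained in the `ε`-neighbourhood of the bounded super-level set of the limit. -/
theorem eventually_superlevel_infDist_le {n : ℕ} {fm : ℕ → En n → ℝ} {f : En n → ℝ}
    (hlcm : ∀ m, LogConcaveFn (fm m))
    (hptw : ∀ x, Tendsto (fun m => fm m x) atTop (nhds (f x)))
    {k : ℝ} (hk0 : 0 < k) (hbdd : Bornology.IsBounded {x | k ≤ f x}) {z : En n} {r : ℝ}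
    (hr : 0 < r) (hz : k ≤ f z) (hball : ∀ᶠ m in atTop, ball z r ⊆ {x | k ≤ fm m x})
    {ε : ℝ} (hε : 0 < ε) :
    ∀ᶠ m in atTop, ∀ x, k ≤ fm m x → infDist x {x | k ≤ f x} ≤ ε := by
  set A : Set (En n) := {x | k ≤ f x} with hA
  set S : Set (En n) := {x | infDist x A = ε} with hS
  have hScpt : IsCompact S := by
    refine Metric.isCompact_of_isClosed_isBounded
      (isClosed_singleton.preimage (continuous_infDist_pt A))
      ((hbdd.thickening (δ := 2 * ε)).subset fun x hx => ?_)
    rw [mem_thickening_iff_infDist_lt ⟨z, hz⟩, show infDist x A = ε from hx]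
    linarith
  have hSm : ∀ᶠ m in atTop, ∀ p ∈ S, ¬ k ≤ fm m p := by
    refine hScpt.induction_on (p := fun T => ∀ᶠ m in atTop, ∀ p ∈ T, ¬ k ≤ fm m p) (by simp)
      (fun T T' h hT => hT.mono fun m hm p hp => hm p (h hp)) (fun T T' hT hT' => ?_) ?_
    · filter_upwards [hT, hT'] with m hm hm' p hp
      exact hp.elim (hm p) (hm' p)
    · intro p hp
      have hd : 0 < dist p z + ε := by positivity
      obtain ⟨t, ht0, ht1, htd⟩ : ∃ t : ℝ, 0 < t ∧ t ≤ 1 ∧ t * dist p z < ε := by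
        refine ⟨ε / (dist p z + ε), by positivity,
          (div_le_one hd).2 (by linarith [dist_nonneg (x := p) (y := z)]), ?_⟩
        rw [div_mul_eq_mul_div, div_lt_iff₀ hd]
        nlinarith
      set q := AffineMap.lineMap p z t with hq
      have hqk : f q < k := by
        by_contra! hqA
        have h1 : infDist p A ≤ dist p q := infDist_le_dist_of_mem hqA
        rw [show infDist p A = ε from hp, hq, dist_left_lineMap, Real.norm_eq_abs,
          abs_of_pos ht0] at h1
        linarith
      have hcont : Continuous fun p' : En n => z + ((1 - t) / t) • (p - p') := by fun_prop
      have hnear : ∀ᶠ p' in nhds p, z + ((1 - t) / t) • (p - p') ∈ ball z r :=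
        hcont.tendsto' p z (by simp) (ball_mem_nhds z hr)
      refine ⟨_, mem_nhdsWithin_of_mem_nhds hnear, ?_⟩
      filter_upwards [hball, (hptw q).eventually_lt_const hqk] with m hm hmq p' hp' hkp'
      have h := (hlcm m).convex_superlevel hk0 hkp' (hm hp') (a := 1 - t) (b := t)
        (by linarith) ht0.le (by ring)
      have he : (1 - t) • p' + t • (z + ((1 - t) / t) • (p - p')) = q := by
        rw [hq, AffineMap.lineMap_apply_module, smul_add, smul_smul, mul_div_cancel₀ _ ht0.ne']
        module
      rw [he] at h
      exact not_le.2 hmq h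
  filter_upwards [hSm, hball] with m hm hb x hx
  by_contra! hlt
  obtain ⟨p, hp, hpε⟩ := (convex_segment z x).isPreconnected.intermediate_value
    (left_mem_segment ℝ z x) (right_mem_segment ℝ z x) (continuous_infDist_pt A).continuousOn
    (show ε ∈ Icc (infDist z A) (infDist x A) from
      ⟨(infDist_zero_of_mem (s := A) hz).trans_le hε.le, hlt.le⟩)
  exact hm p hpε (((hlcm m).convex_superlevel hk0).segment_subset
    (hb (mem_ball_self hr)) hx hp)

/-- if nondegenerate integrable log-concave functions `f_m` converge
pointwise to `f`, then for every `0 < k < ‖f‖_∞` the super-level sets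
`G_{f_m}(k)` converge to `G_f(k)` in the Hausdorff metric. -/
theorem superlevel_sets_hausdorff_convergence {n : ℕ}
    (fm : ℕ → (En n → ℝ)) (f : En n → ℝ)
    (hlcm : ∀ m, LogConcaveFn (fm m))
    (hintm : ∀ m, Integrable (fm m))
    (hndm : ∀ m, (interior {x | 0 < fm m x}).Nonempty)
    (hlc : LogConcaveFn f)
    (hint : Integrable f)
    (hnd : (interior {x | 0 < f x}).Nonempty)
    (hptw : ∀ x, Tendsto (fun m => fm m x) atTop (nhds (f x)))
    (k : ℝ) (hk0 : 0 < k) (hk : k < sSup (Set.range f)) :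
    Tendsto (fun m => Metric.hausdorffDist {x | k ≤ fm m x} {x | k ≤ f x})
      atTop (nhds 0) := by
  obtain ⟨_, ⟨y, rfl⟩, hy⟩ := exists_lt_of_lt_csSup (range_nonempty f) hk
  obtain ⟨z, r, hr, hzf, hzm⟩ := exists_ball_subset_superlevel hlcm hlc hnd hptw hk0 hy
  have hbdd : Bornology.IsBounded {x | k ≤ f x} :=
    (hlc.convex_superlevel hk0).isBounded_of_measure_lt_top volume hr hzf
      (hint.measure_ge_lt_top hk0)
  refine Metric.tendsto_atTop.2 fun ε hε => eventually_atTop.1 ?_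
  filter_upwards [
    eventually_superlevel_dist_le hlc hptw hk0 hy
      (hbdd.isCompact_closure.totallyBounded.subset subset_closure) (half_pos hε),
    eventually_superlevel_infDist_le hlcm hptw hk0 hbdd hr (hzf (mem_ball_self hr)) hzm
      (half_pos (half_pos hε))] with m hinner houter
  rw [Real.dist_0_eq_abs, abs_of_nonneg hausdorffDist_nonneg]
  refine (hausdorffDist_le_of_mem_dist (half_pos hε).le (fun x hx => ?_) hinner).trans_lt
    (half_lt_self hε)
  obtain ⟨w, hw, hxw⟩ := (infDist_lt_iff ⟨y, hy.le⟩).1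
    ((houter x hx).trans_lt (half_lt_self (half_pos hε)))
  exact ⟨w, hw, hxw.le⟩
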